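/- Let c be a positive integer and let b_1 ≥ b_2 ≥ … ≥ b_c be a nonincreasing sequence of positive integers with b_2 > b_3 > … > b_{c-1}. Then there exists a polyunsaturated SGK graph G with clique number c such that Δα_k(G) = b_k for k = 1, …, c; moreover, G may be chosen so that both G and its complement are comparability graphs. -/

import Mathlib

/-- `s` is an independent set of the graph `G`. -/
def IndepSet {V : Type*} (G : SimpleGraph V) (s : Set V) : Prop :=
  ∀ ⦃v⦄, v ∈ s → ∀ ⦃w⦄, w ∈ s → ¬ G.Adj v w

/-- `α_k(G)`: the maximum number of vertices in a union of `k` independent sets. -/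
noncomputable def alphak {V : Type*} (G : SimpleGraph V) (k : ℕ) : ℕ :=
  sSup {n | ∃ A : Fin k → Set V, (∀ i, IndepSet G (A i)) ∧ (⋃ i, A i).ncard = n}

/-- `ω_k(G)`: the maximum number of vertices in a union of `k` cliques. -/
noncomputable def omegak {V : Type*} (G : SimpleGraph V) (k : ℕ) : ℕ :=
  sSup {n | ∃ A : Fin k → Set V, (∀ i, G.IsClique (A i)) ∧ (⋃ i, A i).ncard = n}

/-- The clique number `ω(G)`. -/
noncomputable def cliqueNumber {V : Type*} (G : SimpleGraph V) : ℕ :=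
  sSup {n | ∃ s : Set V, G.IsClique s ∧ s.ncard = n}

/-- The independence number `α(G)`. -/
noncomputable def indepNumber {V : Type*} (G : SimpleGraph V) : ℕ :=
  sSup {n | ∃ s : Set V, IndepSet G s ∧ s.ncard = n}

/-- `f` encodes a partition of the vertices of `G` into cliques:
its (nonempty) fibers are the cliques. -/
def IsCliquePartition {V : Type*} (G : SimpleGraph V) (f : V → V) : Prop :=
  ∀ i : V, G.IsClique (f ⁻¹' {i})

/-- The `k`-norm of the partition encoded by `f`: `Σ_C min (k, |C|)`. -/
noncomputable def knorm {V : Type*} [Fintype V] (f : V → V) (k : ℕ) : ℕ :=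
  ∑ i : V, min k (f ⁻¹' {i}).ncard

/-- `G` is a strong Greene–Kleitman (SGK) graph: every induced subgraph has, for every
positive `k`, a clique partition that is simultaneously `k`- and `k+1`-saturated. -/
def SGK {V : Type*} [Fintype V] (G : SimpleGraph V) : Prop :=
  ∀ (s : Finset V) (k : ℕ), 0 < k →
    ∃ f : (↑s : Set V) → (↑s : Set V),
      IsCliquePartition (G.induce ↑s) f ∧
      knorm f k = alphak (G.induce ↑s) k ∧
      knorm f (k + 1) = alphak (G.induce ↑s) (k + 1)

/-- An SGK graph is polyunsaturated if no clique partition is simultaneously `k`- and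
`l`-saturated for distinct nonconsecutive positive `k, l` below the clique number. -/
def PolyunsatG {V : Type*} [Fintype V] (G : SimpleGraph V) : Prop :=
  ∀ k l : ℕ, 0 < k → 0 < l → k < cliqueNumber G → l < cliqueNumber G →
    (k + 2 ≤ l ∨ l + 2 ≤ k) →
    ¬ ∃ f : V → V, IsCliquePartition G f ∧ knorm f k = alphak G k ∧ knorm f l = alphak G l

/-- `G` is a comparability graph: adjacency is comparability in some partial order. -/
def IsComparabilityGraph {V : Type*} (G : SimpleGraph V) : Prop :=
  ∃ r : V → V → Prop, IsPartialOrder V r ∧ ∀ v w, G.Adj v w ↔ (v ≠ w ∧ (r v w ∨ r w v))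

section Basic

variable {V : Type*} {G : SimpleGraph V}

theorem card_le_alphak [Finite V] {k : ℕ} (A : Fin k → Set V) (hA : ∀ i, IndepSet G (A i)) :
    (⋃ i, A i).ncard ≤ alphak G k := by
  refine le_csSup ⟨Nat.card V, ?_⟩ ⟨A, hA, rfl⟩
  rintro n ⟨B, -, rfl⟩
  rw [← Set.ncard_univ]
  exact Set.ncard_le_ncard (Set.subset_univ _)

theorem alphak_le {k N : ℕ}
    (h : ∀ A : Fin k → Set V, (∀ i, IndepSet G (A i)) → (⋃ i, A i).ncard ≤ N) :
    alphak G k ≤ N := by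
  refine csSup_le' ?_
  rintro n ⟨A, hA, rfl⟩
  exact h A hA

variable [Fintype V]

theorem ncard_fiber [DecidableEq V] (f : V → V) (i : V) :
    (f ⁻¹' {i}).ncard = (Finset.univ.filter fun v => f v = i).card := by
  rw [← Set.ncard_coe_finset]
  congr 1
  ext v
  simp

theorem alphak_le_knorm {f : V → V} (hf : IsCliquePartition G f) (k : ℕ) :
    alphak G k ≤ knorm f k := by
  classical
  refine alphak_le fun A hA => ?_
  set U : Finset V := Finset.univ.filter fun v => v ∈ ⋃ i, A i with hU
  have hcard : (⋃ i, A i).ncard = U.card := by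
    rw [← Set.ncard_coe_finset]
    congr 1
    ext v
    simp [hU]
  rw [hcard, Finset.card_eq_sum_card_fiberwise (f := f) (t := Finset.univ)
    (fun _ _ => Finset.mem_coe.2 (Finset.mem_univ _)), knorm]
  refine Finset.sum_le_sum fun i _ => le_min ?_ ?_
  · have hidx : ∀ v ∈ U, ∃ j, v ∈ A j := by
      intro v hv
      simpa [hU] using hv
    choose idx hidx using hidx
    have := Finset.card_le_card_of_injOn (s := U.filter fun v => f v = i)
      (t := (Finset.univ : Finset (Option (Fin k))).erase none)
      (fun v => if h : v ∈ U then some (idx v h) else none) ?_ ?_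
    · simpa using this
    · intro v hv
      have : v ∈ U := (Finset.mem_filter.1 hv).1
      simp [this]
    · intro u hu v hv huv
      have hu' := Finset.mem_filter.1 hu
      have hv' := Finset.mem_filter.1 hv
      by_contra hne
      simp only [hu'.1, hv'.1, dif_pos, Option.some.injEq] at huv
      refine hA _ (hidx u hu'.1) (huv ▸ hidx v hv'.1 : v ∈ A (idx u hu'.1)) ?_
      exact hf i hu'.2 hv'.2 hne
  · rw [ncard_fiber]
    exact Finset.card_le_card (Finset.filter_subset_filter _ (Finset.subset_univ _))

end Basic

section GreeneKleitman

/-- Integral duality for the assignment problem. -/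
theorem exists_optimal_assignment {A : Type*} [Fintype A] (w : A → A → ℤ) :
    ∃ (σ : Equiv.Perm A) (p q : A → ℤ), (∀ a b, w a b ≤ p a + q b) ∧
      ∀ a, w a (σ a) = p a + q (σ a) := by
  classical
  have hbound : ∀ p q : A → ℤ, (∀ a b, w a b ≤ p a + q b) →
      ∑ a, w a a ≤ ∑ a, p a + ∑ a, q a := by
    intro p q h
    rw [← Finset.sum_add_distrib]
    exact Finset.sum_le_sum fun a _ => h a a
  have hex : ∃ n : ℕ, ∃ p q : A → ℤ, (∀ a b, w a b ≤ p a + q b) ∧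
      ∑ a, p a + ∑ a, q a = ∑ a, w a a + n := by
    have hf : ∀ a b, w a b ≤ (∑ b, |w a b|) + (0 : A → ℤ) b := by
      intro a b
      have := Finset.single_le_sum (f := fun b => |w a b|) (fun _ _ => abs_nonneg _)
        (Finset.mem_univ b)
      have h2 := le_abs_self (w a b)
      simp only [Pi.zero_apply]
      linarith
    obtain ⟨n, hn⟩ := Int.le.dest (hbound _ _ hf)
    exact ⟨n, _, _, hf, hn.symm⟩
  obtain ⟨p, q, hpq, hsum⟩ := Nat.find_spec hex
  have hmin := fun m => Nat.find_min hex (m := m)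
  set n := Nat.find hex
  let t : A → Finset A := fun a => Finset.univ.filter fun b => w a b = p a + q b
  have hall : ∀ s : Finset A, s.card ≤ (s.biUnion t).card := by
    intro s
    by_contra! hlt
    let p' : A → ℤ := fun a => p a - if a ∈ s then 1 else 0
    let q' : A → ℤ := fun b => q b + if b ∈ s.biUnion t then 1 else 0
    have hfeas : ∀ a b, w a b ≤ p' a + q' b := by
      intro a b
      have h1 := hpq a b
      by_cases ha : a ∈ s
      · by_cases hb : b ∈ s.biUnion t
        · simp only [p', q', ha, hb, if_true]
          linarith
        · have hne : w a b ≠ p a + q b := fun h =>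
            hb (Finset.mem_biUnion.2 ⟨a, ha, by simp [t, h]⟩)
          simp only [p', q', ha, hb, if_true, if_false]
          have := lt_of_le_of_ne h1 hne
          linarith
      · simp only [p', q', ha, if_false]
        split_ifs <;> linarith
    have hsum' : ∑ a, p' a + ∑ a, q' a =
        ∑ a, p a + ∑ a, q a - s.card + (s.biUnion t).card := by
      simp only [p', q', Finset.sum_sub_distrib, Finset.sum_add_distrib, Finset.sum_boole,
        Finset.filter_mem_eq_inter, Finset.univ_inter]
      ring
    obtain ⟨m, hm⟩ := Int.le.dest (hbound _ _ hfeas)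
    refine hmin m ?_ ⟨p', q', hfeas, hm.symm⟩
    zify at hlt ⊢
    linarith
  obtain ⟨g, hg, hgt⟩ := (Finset.all_card_le_biUnion_card_iff_exists_injective t).1 hall
  refine ⟨Equiv.ofBijective g (Finite.injective_iff_bijective.1 hg), p, q, hpq, fun a => ?_⟩
  simpa [t] using hgt a

variable {V : Type*} [Fintype V]

/-- Following a permutation as long as it increases gives a map with chains as fibers. -/
theorem exists_chain_tops [PartialOrder V] (σ : Equiv.Perm V) :
    ∃ f : V → V, (∀ u v, f u = f v → u ≤ v ∨ v ≤ u) ∧ (∀ v, ¬ f v < σ (f v)) ∧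
      ∀ v, σ (f v) = f v → f v = v := by
  have hex : ∀ v, ∃ n, ¬ σ^[n] v < σ^[n + 1] v := by
    intro v
    by_contra! h
    exact not_injective_infinite_finite _ (strictMono_nat_of_lt_succ h).injective
  classical
  let n : V → ℕ := fun v => Nat.find (hex v)
  have hmono : ∀ v d, d ≤ n v → v ≤ σ^[d] v := by
    intro v d
    induction d with
    | zero => simp
    | succ d ih =>
      intro hd
      exact (ih (by omega)).trans (not_not.1 (Nat.find_min (hex v) (m := d) hd)).le
  have key : ∀ u v, σ^[n u] u = σ^[n v] v → n u ≤ n v → v ≤ u := by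
    intro u v h hle
    obtain ⟨d, hd⟩ := Nat.exists_eq_add_of_le hle
    rw [hd, Function.iterate_add_apply] at h
    rw [σ.injective.iterate _ h]
    exact hmono v d (by omega)
  refine ⟨fun v => σ^[n v] v, fun u v h => ?_, fun v => ?_, fun v h => ?_⟩
  · rcases le_total (n u) (n v) with hle | hle
    · exact Or.inr (key u v h hle)
    · exact Or.inl (key v u h.symm hle)
  · have := Nat.find_spec (hex v)
    rwa [Function.iterate_succ_apply'] at this
  · have h2 : σ^[n v] (σ^[n v] v) = σ^[n v] v := Function.iterate_fixed h _
    exact σ.injective.iterate _ h2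

/-- The Greene–Kleitman theorem. -/
theorem greene_kleitman [PartialOrder V] {G : SimpleGraph V}
    (hG : ∀ u v, G.Adj u v ↔ u ≠ v ∧ (u ≤ v ∨ v ≤ u)) {k : ℕ} (hk : 0 < k) :
    ∃ f : V → V, IsCliquePartition G f ∧ knorm f k = alphak G k ∧
      knorm f (k + 1) = alphak G (k + 1) := by
  classical
  rcases isEmpty_or_nonempty V with hV | hV
  · have h0 : ∀ f : V → V, ∀ j, knorm f j = 0 := by
      intro f j
      simp [knorm]
    have hp : IsCliquePartition G (id : V → V) := fun i => isEmptyElim i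
    refine ⟨id, hp, ?_, ?_⟩
    · have := alphak_le_knorm hp k
      rw [h0] at this ⊢
      omega
    · have := alphak_le_knorm hp (k + 1)
      rw [h0] at this ⊢
      omega
  let w : V → V → ℤ := fun u v =>
    if u < v then 2 * k + 1 else if u = v then 2 * k - 1 else 0
  have hw0 : ∀ u v, 0 ≤ w u v := by
    intro u v
    simp only [w]
    split_ifs <;> omega
  obtain ⟨σ, p, q, hpq, htight⟩ := exists_optimal_assignment w
  obtain ⟨f, hchain, htop, hloop⟩ := exists_chain_tops σ
  have hf : IsCliquePartition G f := by
    intro i u hu v hv hne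
    exact (hG u v).2 ⟨hne, hchain u v (hu.trans hv.symm)⟩
  obtain ⟨v₀, -, hv₀⟩ := Finset.exists_min_image Finset.univ q Finset.univ_nonempty
  have hq : ∀ v, q v₀ ≤ q v := fun v => hv₀ v (Finset.mem_univ v)
  have hp : ∀ v, -q v₀ ≤ p v := fun v => by
    have := (hw0 v v₀).trans (hpq v v₀)
    linarith
  let L : ℤ → Set V := fun t => {v | q v < q v₀ + t ∧ q v₀ + t ≤ 2 * k + 1 - p v}
  have hLlt : ∀ t u v, u ∈ L t → v ∈ L t → ¬ u < v := by
    intro t u v hu hv hlt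
    have h1 := hpq u v
    simp only [w, hlt, if_true] at h1
    have := hu.2
    have := hv.1
    linarith
  have hL : ∀ t, IndepSet G (L t) := by
    intro t u hu v hv hadj
    obtain ⟨hne, h | h⟩ := (hG u v).1 hadj
    · exact hLlt t u v hu hv (lt_of_le_of_ne h hne)
    · exact hLlt t v u hv hu (lt_of_le_of_ne h hne.symm)
  set O : Set V := ⋃ i : Fin (k + 1), L (2 * (i : ℕ) + 1) with hO
  set E : Set V := ⋃ i : Fin k, L (2 * (i : ℕ) + 2) with hE
  have hOcard : O.ncard ≤ alphak G (k + 1) := card_le_alphak _ fun _ => hL _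
  have hEcard : E.ncard ≤ alphak G k := card_le_alphak _ fun _ => hL _
  have hmemO : ∀ v (i : ℕ), i < k + 1 → v ∈ L (2 * (i : ℕ) + 1) → v ∈ O :=
    fun v i hi hv => Set.mem_iUnion.2 ⟨⟨i, hi⟩, hv⟩
  have hmemE : ∀ v (i : ℕ), i < k → v ∈ L (2 * (i : ℕ) + 2) → v ∈ E :=
    fun v i hi hv => Set.mem_iUnion.2 ⟨⟨i, hi⟩, hv⟩
  have hlevels : ∀ v, 2 * k + 1 - p v - q v ≤
      (if v ∈ O then 1 else 0) + (if v ∈ E then 1 else 0 : ℤ) := by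
    intro v
    have h1 := hpq v v
    have h2 := hp v
    have h3 := hq v
    simp only [w, lt_irrefl, if_false, if_true] at h1
    rcases le_or_gt (2 * k + 1 - p v - q v) 0 with hx | hx
    · split_ifs <;> omega
    obtain ⟨a, ha⟩ := Int.le.dest h3
    obtain ⟨i, hi | hi⟩ := Nat.even_or_odd' a
    · have hvO : v ∈ O := hmemO v i (by omega) ⟨by omega, by omega⟩
      rw [if_pos hvO]
      rcases eq_or_ne (2 * k + 1 - p v - q v) 2 with h | h
      · rw [if_pos (hmemE v i (by omega) ⟨by omega, by omega⟩)]
        omega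
      · split_ifs <;> omega
    · have hvE : v ∈ E := hmemE v i (by omega) ⟨by omega, by omega⟩
      rw [if_pos hvE]
      rcases eq_or_ne (2 * k + 1 - p v - q v) 2 with h | h
      · rw [if_pos (hmemO v (i + 1) (by omega) ⟨by push_cast; omega, by push_cast; omega⟩)]
        omega
      · split_ifs <;> omega
  have hind : ∀ S : Set V, ∑ v, (if v ∈ S then 1 else 0 : ℤ) = S.ncard := by
    intro S
    rw [Finset.sum_boole, ← Set.ncard_coe_finset]
    congr 2
    ext v
    simp
  have hupper : ∑ v, (2 * k + 1 - p v - q v) ≤ (alphak G (k + 1) + alphak G k : ℤ) := by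
    calc ∑ v, (2 * k + 1 - p v - q v)
        ≤ ∑ v, ((if v ∈ O then 1 else 0) + (if v ∈ E then 1 else 0 : ℤ)) :=
          Finset.sum_le_sum fun v _ => hlevels v
      _ = O.ncard + E.ncard := by rw [Finset.sum_add_distrib, hind, hind]
      _ ≤ _ := by exact_mod_cast add_le_add hOcard hEcard
  have hterm : ∀ i, ((min k (f ⁻¹' {i}).ncard + min (k + 1) (f ⁻¹' {i}).ncard : ℕ) : ℤ) ≤
      2 * k + 1 - p i - q (σ i) := by
    intro i
    have h1 := htight i
    have h2 : (2 * k + 1 - p i - q (σ i) : ℤ) = 2 * k + 1 - w i (σ i) := by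
      rw [h1]
      ring
    rw [h2]
    simp only [w]
    split_ifs with hlt heq
    · have : f ⁻¹' {i} = ∅ := by
        ext v
        simp only [Set.mem_preimage, Set.mem_singleton_iff, Set.mem_empty_iff_false, iff_false]
        rintro rfl
        exact htop v hlt
      simp [this]
    · have : f ⁻¹' {i} ⊆ {i} := by
        rintro v rfl
        exact (hloop v heq.symm).symm
      have := Set.ncard_le_ncard this
      rw [Set.ncard_singleton] at this
      omega
    · omega
  have hlower : ((knorm f k + knorm f (k + 1) : ℕ) : ℤ) ≤ ∑ v, (2 * k + 1 - p v - q v) := by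
    have hσ : ∑ v, q (σ v) = ∑ v, q v := Equiv.sum_comp σ q
    calc ((knorm f k + knorm f (k + 1) : ℕ) : ℤ)
        = ∑ i, ((min k (f ⁻¹' {i}).ncard + min (k + 1) (f ⁻¹' {i}).ncard : ℕ) : ℤ) := by
          rw [knorm, knorm, ← Finset.sum_add_distrib, Nat.cast_sum]
      _ ≤ ∑ i, (2 * k + 1 - p i - q (σ i)) := Finset.sum_le_sum fun i _ => hterm i
      _ = _ := by simp only [Finset.sum_sub_distrib, hσ]
  have h1 := alphak_le_knorm hf k
  have h2 := alphak_le_knorm hf (k + 1)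
  exact ⟨f, hf, by omega, by omega⟩

theorem IsComparabilityGraph.sgk {G : SimpleGraph V} (hG : IsComparabilityGraph G) : SGK G := by
  obtain ⟨r, hr, hadj⟩ := hG
  intro s k hk
  let _ : PartialOrder (↑s : Set V) :=
    { le := fun u v => r u v
      le_refl := fun u => hr.refl _
      le_trans := fun u v x => hr.trans _ _ _
      le_antisymm := fun u v h h' => Subtype.ext (hr.antisymm _ _ h h') }
  refine greene_kleitman (fun u v => ?_) hk
  rw [SimpleGraph.comap_adj, hadj]
  exact and_congr_left' Subtype.coe_injective.ne_iff

end GreeneKleitman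

section Coloring

variable {V : Type*} [Fintype V] {G : SimpleGraph V} {col : V → ℕ}

theorem card_fiber_inter_le [DecidableEq V] (hcol : ∀ u v, G.Adj u v → col u ≠ col v)
    {f : V → V} (hf : IsCliquePartition G f) (J : Finset ℕ) (i : V) :
    (Finset.univ.filter fun v => col v ∈ J ∧ f v = i).card ≤
      min J.card (f ⁻¹' {i}).ncard := by
  refine le_min (Finset.card_le_card_of_injOn col ?_ ?_) ?_
  · intro v hv
    exact (Finset.mem_filter.1 hv).2.1
  · intro u hu v hv huv
    by_contra hne
    exact hcol u v (hf i (Finset.mem_filter.1 hu).2.2 (Finset.mem_filter.1 hv).2.2 hne) huv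
  · rw [ncard_fiber]
    exact Finset.card_le_card fun v => by simp

theorem card_colors_eq_sum [DecidableEq V] (f : V → V) (J : Finset ℕ) :
    (Finset.univ.filter fun v => col v ∈ J).card =
      ∑ i, (Finset.univ.filter fun v => col v ∈ J ∧ f v = i).card := by
  rw [Finset.card_eq_sum_card_fiberwise (f := f) (t := Finset.univ)
    (fun _ _ => Finset.mem_coe.2 (Finset.mem_univ _))]
  simp only [Finset.filter_filter]

/-- If the classes of colors in `J` form an optimal family, then the cliques of a saturated
partition that leave this family meet all its classes. -/
theorem exists_color_of_knorm_le (hcol : ∀ u v, G.Adj u v → col u ≠ col v)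
    {f : V → V} (hf : IsCliquePartition G f) {J : Finset ℕ}
    (hJ : knorm f J.card ≤ (Finset.univ.filter fun v => col v ∈ J).card)
    {v : V} (hv : col v ∉ J) {j : ℕ} (hj : j ∈ J) : ∃ u, f u = f v ∧ col u = j := by
  classical
  rw [card_colors_eq_sum f J, knorm] at hJ
  have hle := fun i (_ : i ∈ Finset.univ) => card_fiber_inter_le hcol hf J i
  have heq := (Finset.sum_eq_sum_iff_of_le hle).1 (le_antisymm (Finset.sum_le_sum hle) hJ)
    (f v) (Finset.mem_univ _)
  have hlt : (Finset.univ.filter fun u => col u ∈ J ∧ f u = f v).card <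
      (f ⁻¹' {f v}).ncard := by
    rw [ncard_fiber]
    refine Finset.card_lt_card (Finset.ssubset_iff_of_subset (fun u => by simp) |>.2
      ⟨v, by simp, by simp [hv]⟩)
  have himg : (Finset.univ.filter fun u => col u ∈ J ∧ f u = f v).image col = J := by
    refine Finset.eq_of_subset_of_card_le ?_ ?_
    · intro x hx
      obtain ⟨u, hu, rfl⟩ := Finset.mem_image.1 hx
      exact (Finset.mem_filter.1 hu).2.1
    · rw [Finset.card_image_of_injOn]
      · omega
      · intro a ha b hb hab
        by_contra hne
        exact hcol a b (hf (f v) (Finset.mem_filter.1 ha).2.2 (Finset.mem_filter.1 hb).2.2 hne)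
          hab
  rw [← himg] at hj
  obtain ⟨u, hu, rfl⟩ := Finset.mem_image.1 hj
  exact ⟨u, (Finset.mem_filter.1 hu).2.2, rfl⟩

theorem alphak_le_card_colors {ι : Type*} (g : V → ι)
    (hg : ∀ u v, g u = g v → u ≠ v → G.Adj u v) {J : Finset ℕ}
    (hits : ∀ v, col v ∉ J → ∀ j ∈ J, ∃ u, g u = g v ∧ col u = j) :
    alphak G J.card ≤ (Finset.univ.filter fun v => col v ∈ J).card := by
  classical
  rcases isEmpty_or_nonempty V with hV | hV
  · exact alphak_le fun A _ => by simp [Set.eq_empty_of_isEmpty]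
  let f : V → V := fun v => Function.invFun g (g v)
  have hgf : ∀ v, g (f v) = g v := fun v => Function.invFun_eq ⟨v, rfl⟩
  have hfg : ∀ u v, f u = f v ↔ g u = g v := fun u v =>
    ⟨fun h => by rw [← hgf u, h, hgf], fun h => by simp only [f, h]⟩
  have hf : IsCliquePartition G f := fun i u hu v hv hne =>
    hg u v ((hfg u v).1 (hu.trans hv.symm)) hne
  refine (alphak_le_knorm hf _).trans ?_
  rw [card_colors_eq_sum f J, knorm]
  refine Finset.sum_le_sum fun i _ => ?_
  by_cases hi : ∃ v, f v = i ∧ col v ∉ J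
  · obtain ⟨v, rfl, hv⟩ := hi
    refine (min_le_left _ _).trans ((Finset.card_le_card fun j hj => ?_).trans
      (Finset.card_image_le (f := col)))
    obtain ⟨u, hu, rfl⟩ := hits v hv j hj
    exact Finset.mem_image.2 ⟨u, by simp [hj, (hfg u v).2 hu], rfl⟩
  · push Not at hi
    refine (min_le_right _ _).trans ?_
    rw [ncard_fiber]
    exact Finset.card_le_card fun v => by
      simp only [Finset.mem_filter, Finset.mem_univ, true_and]
      exact fun h => ⟨hi v h, h⟩

theorem card_colors_le_alphak (hcol : ∀ u v, G.Adj u v → col u ≠ col v) (k : ℕ) :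
    (Finset.univ.filter fun v => col v ∈ Finset.Icc 1 k).card ≤ alphak G k := by
  refine le_trans (le_of_eq ?_) (card_le_alphak (fun i : Fin k => {v | col v = i + 1}) ?_)
  · rw [← Set.ncard_coe_finset]
    congr 1
    ext v
    simp only [Finset.coe_filter, Finset.mem_univ, true_and, Finset.mem_Icc, Set.mem_ofPred_eq,
      Set.mem_iUnion]
    exact ⟨fun h => ⟨⟨col v - 1, by omega⟩, by simp only; omega⟩, fun ⟨i, hi⟩ => by omega⟩
  · intro i u hu v hv hadj
    exact hcol u v hadj (hu.trans hv.symm)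

theorem cliqueNumber_eq_of_coloring {c : ℕ} (hcol : ∀ u v, G.Adj u v → col u ≠ col v)
    (hmem : ∀ v, col v ∈ Finset.Icc 1 c) {s : Set V} (hs : G.IsClique s)
    (hsc : ∀ j ∈ Finset.Icc 1 c, ∃ v ∈ s, col v = j) : cliqueNumber G = c := by
  classical
  have hle : ∀ t : Set V, G.IsClique t → t.ncard ≤ c := by
    intro t ht
    have := Set.ncard_le_ncard_of_injOn (s := t) (t := (Finset.Icc 1 c : Finset ℕ)) col
      (fun v _ => hmem v) (fun u hu v hv huv => by
        by_contra hne
        exact hcol u v (ht hu hv hne) huv)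
    rwa [Set.ncard_coe_finset, Nat.card_Icc, Nat.add_sub_cancel] at this
  have hge : c ≤ s.ncard := by
    have h1 := Set.ncard_image_le (f := col) (s := s)
    have h2 : ((Finset.Icc 1 c : Finset ℕ) : Set ℕ) ⊆ col '' s := fun j hj => hsc j hj
    have h3 := Set.ncard_le_ncard h2
    rw [Set.ncard_coe_finset, Nat.card_Icc, Nat.add_sub_cancel] at h3
    omega
  refine le_antisymm (csSup_le' ?_) (hge.trans (le_csSup ⟨c, ?_⟩ ⟨s, hs, rfl⟩)) <;>
  · rintro n ⟨t, ht, rfl⟩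
    exact hle t ht

end Coloring

theorem isComparabilityGraph_of_strictOrder {V : Type*} {G : SimpleGraph V} (r : V → V → Prop)
    (hirr : ∀ u, ¬ r u u) (htrans : ∀ u v w, r u v → r v w → r u w)
    (hadj : ∀ u v, G.Adj u v ↔ r u v ∨ r v u) : IsComparabilityGraph G := by
  refine ⟨fun u v => u = v ∨ r u v, ?_, fun u v => ?_⟩
  · refine { refl := fun u => Or.inl rfl, trans := ?_, antisymm := ?_ }
    · rintro u v w (rfl | huv) (rfl | hvw)
      · exact Or.inl rfl
      · exact Or.inr hvw
      · exact Or.inr huv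
      · exact Or.inr (htrans _ _ _ huv hvw)
    · rintro u v (rfl | huv) (h | hvu)
      · rfl
      · rfl
      · exact h.symm
      · exact absurd (htrans _ _ _ huv hvu) (hirr u)
  · rw [hadj]
    constructor
    · intro h
      refine ⟨?_, h.imp Or.inr Or.inr⟩
      rintro rfl
      exact hirr u (h.elim id id)
    · rintro ⟨hne, (h | h) | (h | h)⟩
      · exact absurd h hne
      · exact Or.inl h
      · exact absurd h.symm hne
      · exact Or.inr h

/-- The elements of the poset: a chain `spine`, decreasing in its parameter; an element `leaf a`
attached above `spine a`; a chain `hair _ a` attached below `spine a`; and further components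
`bar _ t`, which are chains. -/
inductive Elt where
  | spine (h : ℕ)
  | leaf (a : ℕ)
  | hair (h a : ℕ)
  | bar (j t : ℕ)

namespace Elt

/-- The strict order. -/
def Below : Elt → Elt → Prop
  | spine h, spine h' => h' < h
  | spine h, leaf a => a ≤ h
  | hair h a, hair h' a' => a = a' ∧ h' < h
  | hair _ a, spine h => h ≤ a
  | hair _ a, leaf a' => a' ≤ a
  | bar j t, bar j' t' => t = t' ∧ j < j'
  | _, _ => False

/-- A strict order whose comparabilities are the incomparabilities of `Below`. -/
def LeftOf : Elt → Elt → Prop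
  | leaf a, spine h => h < a
  | leaf a, leaf a' => a' < a
  | leaf a', hair _ a => a < a'
  | spine h, hair _ a => a < h
  | hair _ a, hair _ a' => a' < a
  | bar _ t, bar _ t' => t < t'
  | bar _ _, _ => False
  | _, bar _ _ => True
  | _, _ => False

theorem below_irrefl (u : Elt) : ¬ Below u u := by
  cases u <;> simp [Below]

theorem below_trans (u v w : Elt) : Below u v → Below v w → Below u w := by
  intro huv hvw
  cases u <;> cases v <;> cases w <;> simp only [Below] at * <;> omega

theorem leftOf_irrefl (u : Elt) : ¬ LeftOf u u := by
  cases u <;> simp [LeftOf]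

theorem leftOf_trans (u v w : Elt) : LeftOf u v → LeftOf v w → LeftOf u w := by
  intro huv hvw
  cases u <;> cases v <;> cases w <;> simp only [LeftOf] at * <;> omega

theorem leftOf_or_leftOf_iff (u v : Elt) :
    LeftOf u v ∨ LeftOf v u ↔ u ≠ v ∧ ¬ (Below u v ∨ Below v u) := by
  cases u <;> cases v <;> grind [LeftOf, Below]

/-- The number of elements of color `j` outside the chains `bar`. -/
def coreSize (c j : ℕ) : ℕ :=
  if c ≤ 2 then 0 else if j = 1 then c - 2 else if j = c then 1 else c - j

/-- The elements that occur for the parameters `c` and `b`. -/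
def Valid (c : ℕ) (b : ℕ → ℕ) : Elt → Prop
  | spine h => 3 ≤ c ∧ h + 2 ≤ c
  | leaf a => a + 2 < c
  | hair h a => a + 2 ≤ h ∧ h + 2 ≤ c
  | bar j t => 1 ≤ j ∧ j ≤ c ∧ t + coreSize c j < b j

/-- A coloring whose classes are antichains. -/
def color (c : ℕ) : Elt → ℕ
  | spine h => c - h
  | leaf _ => 1
  | hair h _ => c - h
  | bar j _ => j

/-- The position of an element in its color class. -/
def index (c : ℕ) : Elt → ℕ
  | spine h => h - 1
  | leaf a => a
  | hair _ a => a
  | bar j t => t + coreSize c j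

/-- The element of color `j` at position `t`. -/
def ofIndex (c j t : ℕ) : Elt :=
  if coreSize c j ≤ t then bar j (t - coreSize c j)
  else if j = 1 then leaf t
  else if c ≤ t + 1 + j then spine (c - j)
  else hair (c - j) t

variable {c : ℕ} {b : ℕ → ℕ}

theorem color_mem (hc : 0 < c) {u : Elt} (hu : Valid c b u) : color c u ∈ Finset.Icc 1 c := by
  rw [Finset.mem_Icc]
  cases u <;> simp only [Valid, color] at hu ⊢ <;> omega

theorem color_ne_of_below {u v : Elt} (hu : Valid c b u) (hv : Valid c b v) (h : Below u v) :
    color c u ≠ color c v := by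
  cases u <;> cases v <;> simp only [Valid, Below, color] at * <;> omega

theorem ofIndex_color_index {u : Elt} (hu : Valid c b u) :
    ofIndex c (color c u) (index c u) = u := by
  cases u <;> grind [Valid, color, index, ofIndex, coreSize]

section Sizes

variable (hd : ∀ i j, 1 ≤ i → i ≤ j → j ≤ c → b j + coreSize c i ≤ b i + coreSize c j)
  (hcore : ∀ j, 1 ≤ j → j ≤ c → coreSize c j ≤ b j)

include hcore in
theorem index_lt {u : Elt} (hu : Valid c b u) : index c u < b (color c u) := by
  cases u with
  | bar j t => exact hu.2.2
  | spine h =>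
    have := hcore (c - h)
    simp only [Valid, color, index, coreSize] at *
    split_ifs at this <;> omega
  | leaf a =>
    have := hcore 1
    simp only [Valid, color, index, coreSize] at *
    split_ifs at this <;> omega
  | hair h a =>
    have := hcore (c - h)
    simp only [Valid, color, index, coreSize] at *
    split_ifs at this <;> omega

theorem ofIndex_spec {j t : ℕ} (hj : 1 ≤ j) (hjc : j ≤ c) (ht : t < b j) :
    Valid c b (ofIndex c j t) ∧ color c (ofIndex c j t) = j ∧ index c (ofIndex c j t) = t := by
  grind [Valid, color, index, ofIndex, coreSize]

/-- Labels of the chains of a partition that is saturated for `k`. -/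
def label (c k : ℕ) : Elt → Elt
  | spine h => leaf (min h (max 1 (c - 1 - k) - 1))
  | leaf a => leaf a
  | hair h a => if a + 2 ≤ max 1 (c - 1 - k) then leaf a else hair h a
  | bar _ t => bar 1 t

theorem below_of_label_eq {k : ℕ} {u v : Elt} (huv : label c k u = label c k v) (hne : u ≠ v) :
    Below u v ∨ Below v u := by
  cases u <;> cases v <;> simp only [label] at huv <;> (try split_ifs at huv) <;>
    simp only [Below, ne_eq, spine.injEq, leaf.injEq, hair.injEq, bar.injEq, reduceCtorEq] at * <;>
    omega

include hd in
theorem exists_label_eq {k : ℕ} {v : Elt} (hv : Valid c b v) (hkv : k < color c v) {j : ℕ}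
    (hj : 1 ≤ j) (hjk : j ≤ k) :
    ∃ u, Valid c b u ∧ label c k u = label c k v ∧ color c u = j := by
  cases v with
  | spine h =>
    simp only [Valid, color] at hv hkv
    rcases eq_or_lt_of_le hj with rfl | hj
    · refine ⟨leaf (min h (max 1 (c - 1 - k) - 1)), ?_, rfl, rfl⟩
      simp only [Valid]
      omega
    · by_cases hh : h + 2 ≤ max 1 (c - 1 - k)
      · refine ⟨hair (c - j) h, ?_, ?_, ?_⟩
        · simp only [Valid]
          omega
        · simp only [label, if_pos hh, leaf.injEq]
          omega
        · simp only [color]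
          omega
      · refine ⟨spine (c - j), ?_, ?_, ?_⟩
        · simp only [Valid]
          omega
        · simp only [label, leaf.injEq]
          omega
        · simp only [color]
          omega
  | leaf a =>
    simp only [color] at hkv
    omega
  | hair h a =>
    simp only [Valid, color] at hv hkv
    have ha : a + 2 ≤ max 1 (c - 1 - k) := by omega
    rcases eq_or_lt_of_le hj with rfl | hj
    · refine ⟨leaf a, ?_, ?_, rfl⟩
      · simp only [Valid]
        omega
      · simp only [label, if_pos ha]
    · refine ⟨hair (c - j) a, ?_, ?_, ?_⟩
      · simp only [Valid]
        omega
      · simp only [label, if_pos ha]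
      · simp only [color]
        omega
  | bar i t =>
    simp only [Valid, color] at hv hkv
    refine ⟨bar j t, ?_, rfl, rfl⟩
    have := hd j i hj (by omega) (by omega)
    simp only [Valid]
    omega

end Sizes

/-- Chains cannot meet the color classes as required by saturation for both `k` and `l`. -/
theorem not_saturated {ι : Type*} (F : Elt → ι) {k l : ℕ} (hkl : k + 2 ≤ l) (hk : 0 < k)
    (hlc : l < c)
    (hchain : ∀ u v, Valid c b u → Valid c b v → F u = F v → u ≠ v → Below u v ∨ Below v u)
    (hitk : ∀ v, Valid c b v → k < color c v → ∃ u, Valid c b u ∧ color c u = 1 ∧ F u = F v)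
    (hitl : ∀ v, Valid c b v → l < color c v → ∃ u, Valid c b u ∧ color c u = l ∧ F u = F v) :
    False := by
  obtain ⟨e, he⟩ : ∃ e, e + l + 1 = c := ⟨c - l - 1, by omega⟩
  have hleaf : ∀ v, Valid c b v → k < color c v → (∀ j t, v ≠ bar j t) →
      ∃ a, Valid c b (leaf a) ∧ Below v (leaf a) ∧ F (leaf a) = F v := by
    intro v hv hkv hbar
    obtain ⟨u, hu, hu1, hF⟩ := hitk v hv hkv
    have hne : u ≠ v := by
      rintro rfl
      omega
    have hcomp := hchain u v hu hv hF hne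
    cases u with
    | leaf a =>
      refine ⟨a, hu, ?_, hF⟩
      cases v <;> grind [Below, color]
    | bar j t =>
      cases v <;> simp only [Below, or_self, bar.injEq, ne_eq] at *
      exact absurd ⟨rfl, rfl⟩ (hbar _ _)
    | _ =>
      simp only [Valid, color] at hu hu1
      omega
  have hvalid : ∀ a ≤ e, Valid c b (hair (max e (a + 2)) a) := by
    intro a ha
    simp only [Valid]
    omega
  have htop : ∀ a ≤ e, F (leaf a) = F (hair (max e (a + 2)) a) := by
    intro a
    induction a using Nat.strong_induction_on with
    | _ a ih =>
      intro ha
      obtain ⟨a', -, hbelow, hF⟩ := hleaf _ (hvalid a ha) (by simp only [color]; omega) (by simp)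
      simp only [Below] at hbelow
      rcases eq_or_lt_of_le hbelow with rfl | hlt
      · exact hF
      · have := hchain _ _ (hvalid a' (by omega)) (hvalid a ha)
          ((ih a' hlt (by omega)).symm.trans hF) (by simp only [ne_eq, hair.injEq]; omega)
        simp only [Below] at this
        omega
  have hspine : Valid c b (spine e) := by
    simp only [Valid]
    omega
  obtain ⟨a, -, hbelow, hF⟩ := hleaf _ hspine (by simp only [color]; omega) (by simp)
  simp only [Below] at hbelow
  have hF' := (htop a hbelow).symm.trans hF
  have hcomp := hchain _ _ (hvalid a hbelow) hspine hF' (by simp)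
  simp only [Below, or_false] at hcomp
  obtain rfl : a = e := by omega
  obtain ⟨u, hu, hul, hFu⟩ := hitl _ hspine (by simp only [color]; omega)
  have hne₁ : u ≠ spine a := by
    rintro rfl
    simp only [color] at hul
    omega
  have hne₂ : u ≠ hair (max a (a + 2)) a := by
    rintro rfl
    simp only [color] at hul
    omega
  have h₁ := hchain _ _ hu hspine hFu hne₁
  have h₂ := hchain _ _ hu (hvalid a le_rfl) (hFu.trans hF'.symm) hne₂
  cases u <;> grind [Valid, color, Below]

end Elt

namespace Elt

theorem coreSize_exchange {c : ℕ} {b : ℕ → ℕ}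
    (hmono : ∀ k l, 1 ≤ k → k ≤ l → l ≤ c → b l ≤ b k)
    (hstrict : ∀ k, 2 ≤ k → k + 2 ≤ c → b (k + 1) < b k) (i j : ℕ) (hi : 1 ≤ i) (hij : i ≤ j)
    (hjc : j ≤ c) : b j + coreSize c i ≤ b i + coreSize c j := by
  induction j, hij using Nat.le_induction with
  | base => exact le_rfl
  | succ j hij ih =>
    have hih := ih (by omega)
    have hm := hmono j (j + 1) (by omega) (by omega) hjc
    have hs := hstrict j
    unfold coreSize at *
    split_ifs at * <;> omega

theorem coreSize_le {c : ℕ} {b : ℕ → ℕ} (hpos : ∀ k, 1 ≤ k → k ≤ c → 0 < b k)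
    (hd : ∀ i j, 1 ≤ i → i ≤ j → j ≤ c → b j + coreSize c i ≤ b i + coreSize c j) (j : ℕ)
    (hj : 1 ≤ j) (hjc : j ≤ c) : coreSize c j ≤ b j := by
  have hdj := hd j c hj hjc le_rfl
  have hpc := hpos c (by omega) le_rfl
  have hcore : coreSize c c ≤ 1 := by
    unfold coreSize
    split_ifs <;> omega
  omega

/-- The elements that occur for the parameters `c` and `b`, as a type. -/
abbrev Vertex (c : ℕ) (b : ℕ → ℕ) : Type := {u : Elt // Valid c b u}

/-- Vertices correspond to pairs of a color and a position in its color class. -/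
def vertexEquiv {c : ℕ} {b : ℕ → ℕ} (hc : 0 < c)
    (hcore : ∀ j, 1 ≤ j → j ≤ c → coreSize c j ≤ b j) :
    Vertex c b ≃ {p : ℕ × ℕ // p.1 ∈ Finset.Icc 1 c ∧ p.2 < b p.1} where
  toFun u := ⟨(color c u, index c u), color_mem hc u.2, index_lt hcore u.2⟩
  invFun p := ⟨ofIndex c p.1.1 p.1.2, (ofIndex_spec (Finset.mem_Icc.1 p.2.1).1
    (Finset.mem_Icc.1 p.2.1).2 p.2.2).1⟩
  left_inv u := Subtype.ext (ofIndex_color_index u.2)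
  right_inv p := Subtype.ext (Prod.ext_iff.2 (ofIndex_spec (Finset.mem_Icc.1 p.2.1).1
    (Finset.mem_Icc.1 p.2.1).2 p.2.2).2)

theorem finite_vertex {c : ℕ} {b : ℕ → ℕ} (hc : 0 < c)
    (hcore : ∀ j, 1 ≤ j → j ≤ c → coreSize c j ≤ b j) : Finite (Vertex c b) := by
  refine @Finite.of_equiv _ _ (Set.Finite.to_subtype ?_) (vertexEquiv hc hcore).symm
  refine ((Finset.Icc 1 c).sigma fun j => Finset.range (b j)).finite_toSet.image
    (fun p => (p.1, p.2)) |>.subset ?_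
  rintro ⟨j, t⟩ ⟨hj, ht⟩
  exact ⟨⟨j, t⟩, by simp_all, rfl⟩

end Elt

section Construction

open Elt

variable {c : ℕ} {b : ℕ → ℕ} {V : Type*} (e : V ≃ Vertex c b)

/-- The comparability graph of the poset, on any type in bijection with its elements. -/
def eltGraph : SimpleGraph V where
  Adj u v := Below (e u) (e v) ∨ Below (e v) (e u)
  symm := ⟨fun _ _ => Or.symm⟩
  loopless := ⟨fun _ h => below_irrefl _ (h.elim id id)⟩

theorem isComparabilityGraph_eltGraph : IsComparabilityGraph (eltGraph e) :=
  isComparabilityGraph_of_strictOrder (fun u v => Below (e u) (e v)) (fun _ => below_irrefl _)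
    (fun _ _ _ => below_trans _ _ _) fun _ _ => Iff.rfl

theorem isComparabilityGraph_compl_eltGraph : IsComparabilityGraph (eltGraph e)ᶜ :=
  isComparabilityGraph_of_strictOrder (fun u v => LeftOf (e u) (e v)) (fun _ => leftOf_irrefl _)
    (fun _ _ _ => leftOf_trans _ _ _) fun u v => by
      rw [leftOf_or_leftOf_iff, SimpleGraph.compl_adj, ne_eq, ne_eq, Subtype.val_inj,
        e.apply_eq_iff_eq]
      rfl

theorem color_ne_of_adj (u v : V) (h : (eltGraph e).Adj u v) :
    color c (e u) ≠ color c (e v) :=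
  h.elim (color_ne_of_below (e u).2 (e v).2) fun h => (color_ne_of_below (e v).2 (e u).2 h).symm

theorem adj_of_label_eq {k : ℕ} {u v : V} (h : label c k (e u) = label c k (e v)) (hne : u ≠ v) :
    (eltGraph e).Adj u v :=
  below_of_label_eq h (by rwa [ne_eq, Subtype.val_inj, e.apply_eq_iff_eq])

theorem card_color_eq [Fintype V] (hcore : ∀ j, 1 ≤ j → j ≤ c → coreSize c j ≤ b j) {j : ℕ} (hj : 1 ≤ j)
    (hjc : j ≤ c) : (Finset.univ.filter fun v => color c (e v) = j).card = b j := by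
  rw [← Finset.card_range (b j)]
  refine Finset.card_bij (fun v _ => index c (e v)) ?_ ?_ ?_
  · intro v hv
    rw [Finset.mem_filter] at hv
    rw [Finset.mem_range, ← hv.2]
    exact index_lt hcore (e v).2
  · intro u hu v hv huv
    rw [Finset.mem_filter] at hu hv
    rw [← e.apply_eq_iff_eq, ← Subtype.val_inj, ← ofIndex_color_index (e u).2,
      ← ofIndex_color_index (e v).2, hu.2, hv.2, huv]
  · intro t ht
    obtain ⟨h₁, h₂, h₃⟩ := ofIndex_spec (b := b) hj hjc (Finset.mem_range.1 ht)
    exact ⟨e.symm ⟨_, h₁⟩, by simp [h₂], by simp [h₃]⟩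

variable [Fintype V]
  (hd : ∀ i j, 1 ≤ i → i ≤ j → j ≤ c → b j + coreSize c i ≤ b i + coreSize c j)

include hd in
theorem alphak_eltGraph (hc : 0 < c) (k : ℕ) :
    alphak (eltGraph e) k =
      (Finset.univ.filter fun v => color c (e v) ∈ Finset.Icc 1 k).card := by
  refine le_antisymm ?_ (card_colors_le_alphak (color_ne_of_adj e) k)
  have := alphak_le_card_colors (G := eltGraph e) (col := fun v => color c (e v))
    (fun v => label c k (e v)) (fun _ _ => adj_of_label_eq e) (J := Finset.Icc 1 k) ?_
  · rwa [Nat.card_Icc, Nat.add_sub_cancel] at this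
  · intro v hv j hj
    have hcol := Finset.mem_Icc.1 (color_mem hc (e v).2)
    rw [Finset.mem_Icc] at hv hj
    obtain ⟨u, hu, hul, huj⟩ :=
      exists_label_eq hd (e v).2 (by omega : k < color c (e v)) hj.1 hj.2
    exact ⟨e.symm ⟨u, hu⟩, by simpa using hul, by simpa using huj⟩

include hd in
theorem alphak_eltGraph_succ (hc : 0 < c) (hcore : ∀ j, 1 ≤ j → j ≤ c → coreSize c j ≤ b j)
    {k : ℕ} (hk : k + 1 ≤ c) :
    alphak (eltGraph e) (k + 1) = alphak (eltGraph e) k + b (k + 1) := by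
  classical
  rw [alphak_eltGraph e hd hc, alphak_eltGraph e hd hc,
    ← card_color_eq e hcore (by omega) hk, ← Finset.card_union_of_disjoint]
  · congr 1
    ext v
    simp only [Finset.mem_filter, Finset.mem_univ, true_and, Finset.mem_union, Finset.mem_Icc]
    omega
  · rw [Finset.disjoint_filter]
    intro v _ h
    rw [Finset.mem_Icc] at h
    omega

include hd in
theorem cliqueNumber_eltGraph (hc : 0 < c) (hpos : 0 < b c) : cliqueNumber (eltGraph e) = c := by
  obtain ⟨h₁, h₂, -⟩ := ofIndex_spec (b := b) hc le_rfl hpos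
  refine cliqueNumber_eq_of_coloring (color_ne_of_adj e) (fun v => color_mem hc (e v).2)
    (s := {u | label c (c - 1) (e u) = label c (c - 1) (ofIndex c c 0)}) ?_ ?_
  · intro u hu v hv
    exact adj_of_label_eq e (Eq.trans hu (Eq.symm hv))
  · intro j hj
    rw [Finset.mem_Icc] at hj
    rcases eq_or_lt_of_le hj.2 with rfl | hjc
    · exact ⟨e.symm ⟨_, h₁⟩, by simp, by simpa using h₂⟩
    · obtain ⟨u, hu, hul, huj⟩ :=
        exists_label_eq hd h₁ (by omega : c - 1 < _) hj.1 (by omega : j ≤ c - 1)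
      exact ⟨e.symm ⟨u, hu⟩, by simpa using hul, by simpa using huj⟩

include hd in
theorem not_saturated_eltGraph (hc : 0 < c) {k l : ℕ} (hk : 0 < k) (hkl : k + 2 ≤ l) (hlc : l < c)
    {f : V → V} (hf : IsCliquePartition (eltGraph e) f)
    (hfk : knorm f k = alphak (eltGraph e) k) (hfl : knorm f l = alphak (eltGraph e) l) :
    False := by
  classical
  have hits : ∀ m, knorm f m = alphak (eltGraph e) m → ∀ j, 1 ≤ j → j ≤ m → ∀ v : V,
      m < color c (e v) → ∃ u, f u = f v ∧ color c (e u) = j := by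
    intro m hfm j hj hjm v hv
    refine exists_color_of_knorm_le (color_ne_of_adj e) hf (J := Finset.Icc 1 m) ?_ ?_ ?_
    · rw [Nat.card_Icc, Nat.add_sub_cancel, hfm, alphak_eltGraph e hd hc]
    · rw [Finset.mem_Icc]
      omega
    · exact Finset.mem_Icc.2 ⟨hj, hjm⟩
  let F : Elt → Option V := fun u => if h : Valid c b u then some (f (e.symm ⟨u, h⟩)) else none
  have hF : ∀ v : V, F (e v) = some (f v) := fun v => by simp [F, (e v).2]
  have hlift : ∀ u, Valid c b u → ∃ v, (e v : Elt) = u := fun u hu => ⟨e.symm ⟨u, hu⟩, by simp⟩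
  refine not_saturated F hkl hk hlc (b := b) ?_ ?_ ?_
  · intro u v hu hv huv hne
    obtain ⟨u, rfl⟩ := hlift u hu
    obtain ⟨v, rfl⟩ := hlift v hv
    rw [hF, hF, Option.some_inj] at huv
    exact hf (f v) huv rfl fun h => hne (h ▸ rfl)
  · intro v hv hkv
    obtain ⟨v, rfl⟩ := hlift v hv
    obtain ⟨u, hu, huc⟩ := hits k hfk 1 le_rfl hk v hkv
    exact ⟨e u, (e u).2, huc, by rw [hF, hF, hu]⟩
  · intro v hv hlv
    obtain ⟨v, rfl⟩ := hlift v hv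
    obtain ⟨u, hu, huc⟩ := hits l hfl l (by omega) le_rfl v hlv
    exact ⟨e u, (e u).2, huc, by rw [hF, hF, hu]⟩

end Construction

/-- Given a positive integer `c` and a nonincreasing sequence `b 1 ≥ … ≥ b c` of positive
integers with `b 2 > b 3 > … > b (c-1)`, there is a polyunsaturated SGK graph `G` with
clique number `c` and `Δα_k(G) = b k` for `k = 1, …, c`, such that moreover both `G` and
its complement are comparability graphs. -/
theorem statement10 (c : ℕ) (hc : 0 < c) (b : ℕ → ℕ)
    (hpos : ∀ k, 1 ≤ k → k ≤ c → 0 < b k)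
    (hmono : ∀ k l, 1 ≤ k → k ≤ l → l ≤ c → b l ≤ b k)
    (hstrict : ∀ k, 2 ≤ k → k + 2 ≤ c → b (k + 1) < b k) :
    ∃ (n : ℕ) (G : SimpleGraph (Fin n)),
      SGK G ∧ PolyunsatG G ∧ cliqueNumber G = c ∧
      (∀ k, 1 ≤ k → k ≤ c → alphak G k = alphak G (k - 1) + b k) ∧
      IsComparabilityGraph G ∧ IsComparabilityGraph Gᶜ := by
  have hd := Elt.coreSize_exchange hmono hstrict
  have hcore := Elt.coreSize_le hpos hd
  have := Elt.finite_vertex hc hcore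
  obtain ⟨n, ⟨e⟩⟩ := Finite.exists_equiv_fin (Elt.Vertex c b)
  have hω := cliqueNumber_eltGraph e.symm hd hc (hpos c hc le_rfl)
  refine ⟨n, eltGraph e.symm, (isComparabilityGraph_eltGraph _).sgk, ?_, hω, ?_,
    isComparabilityGraph_eltGraph _, isComparabilityGraph_compl_eltGraph _⟩
  · rintro k l hk hl hkc hlc hkl ⟨f, hf, hfk, hfl⟩
    rw [hω] at hkc hlc
    rcases hkl with hkl | hkl
    · exact not_saturated_eltGraph e.symm hd hc hk hkl hlc hf hfk hfl
    · exact not_saturated_eltGraph e.symm hd hc hl hkl hkc hf hfl hfk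
  · intro k hk hkc
    obtain ⟨k, rfl⟩ := Nat.exists_eq_succ_of_ne_zero (by omega : k ≠ 0)
    exact alphak_eltGraph_succ e.symm hd hc hcore hkc
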